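/- Let d, e, f be positive natural numbers and let t : Fin d → Fin e → ℚ and u : Fin d → Fin f → ℚ be families of rational numbers (the evaluated terms of a formula in conjunctive normal form with order inequalities). Then the conjunction ∀ i : Fin d, ((∃ j : Fin e, t i j = 0) ∨ (∃ k : Fin f, u i k > 0)) holds if and only if for every v : ℚ there exist w₁ w₂ w₃ : ℚ such that, writing W = w₁^2 + w₂^2 + w₃^2, one has (1 − w₁ · ∏_{i : Fin d} (v − (i+1))) · (∑_{i : Fin d} (∏_{h : Fin d, h ≠ i} (v − (h+1))) · (∏_{j : Fin e} t i j) · (∏_{k : Fin f} (1 − (u i k)·W) · (1 − 2·(u i k)·W))) = 0, where i+1 and h+1 denote the natural numbers 1, …, d cast into ℚ. -/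

import Mathlib

lemma aux_prime (n : ℕ) (hn : n % 4 = 2) :
    ∃ q b : ℕ, q.Prime ∧ q % 4 = 1 ∧ q + 1 = b * n ∧ n < q ∧ IsSquare ((n : ℤ) : ZMod q) := by
  have hcop : (n - 1).Coprime (4 * n) := by
    apply Nat.Coprime.mul_right
    · have : (n - 1).Coprime 2 := by
        rw [Nat.coprime_two_right]; exact Nat.odd_iff.mpr (by omega)
      exact Nat.Coprime.pow_right 2 this
    · have h : n = (n - 1) + 1 := by omega
      rw [h]
      simp
  obtain ⟨q, hq, hp, hmod⟩ := Nat.forall_exists_prime_gt_and_modEq (4 * n) (q := 4 * n) (a := n - 1)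
    (by omega) hcop
  have hle : n - 1 ≤ q := by omega
  obtain ⟨k, hk⟩ := (Nat.modEq_iff_dvd' hle).mp hmod.symm
  have hb : q + 1 = (4 * k + 1) * n := by
    have : (4 * k + 1) * n = 4 * n * k + n := by ring
    omega
  have hq4 : q % 4 = 1 := by
    have : 4 * n * k = 4 * (n * k) := by ring
    omega
  haveI : Fact q.Prime := ⟨hp⟩
  refine ⟨q, 4 * k + 1, hp, hq4, hb, by omega, ?_⟩
  apply ZMod.isSquare_of_jacobiSym_eq_one
  have h1 : jacobiSym (((4 * k + 1 : ℕ) : ℤ)) q = 1 := by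
    rw [jacobiSym.quadratic_reciprocity_one_mod_four (by omega) (Nat.odd_iff.mpr (by omega))]
    have : jacobiSym (q : ℤ) (4 * k + 1) = jacobiSym (-1) (4 * k + 1) := by
      apply jacobiSym.mod_left'
      apply Int.ModEq.symm
      rw [Int.modEq_iff_dvd]
      refine ⟨n, ?_⟩
      have : (q : ℤ) + 1 = (4 * k + 1 : ℕ) * n := by exact_mod_cast hb
      linarith
    rw [this, jacobiSym.at_neg_one (Nat.odd_iff.mpr (by omega)),
      ZMod.χ₄_nat_one_mod_four (by omega)]
  have h2 : jacobiSym (((4 * k + 1 : ℕ) : ℤ) * n) q = 1 := by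
    have : jacobiSym (((4 * k + 1 : ℕ) : ℤ) * n) q = jacobiSym 1 q := by
      apply jacobiSym.mod_left'
      apply Int.ModEq.symm
      rw [Int.modEq_iff_dvd]
      refine ⟨1, ?_⟩
      have : (q : ℤ) + 1 = (4 * k + 1 : ℕ) * n := by exact_mod_cast hb
      linarith
    rw [this, jacobiSym.one_left]
  rw [jacobiSym.mul_left, h1, one_mul] at h2
  exact h2

lemma aux_pigeon (n q : ℕ) (hn : 0 < n) (hq : 0 < q) (r : ℤ) :
    ∃ z s t : ℤ, ¬ (z = 0 ∧ s = 0 ∧ t = 0) ∧ z ^ 2 ≤ n * q ∧ s ^ 2 ≤ n ∧ t ^ 2 ≤ q ∧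
      (n : ℤ) ∣ z - s ∧ (q : ℤ) ∣ z - r * t := by
  haveI : NeZero n := ⟨by omega⟩
  haveI : NeZero q := ⟨by omega⟩
  let S : Finset (ℕ × ℕ × ℕ) := Finset.range ((n * q).sqrt + 1) ×ˢ
    (Finset.range (n.sqrt + 1) ×ˢ Finset.range (q.sqrt + 1))
  let F : ℕ × ℕ × ℕ → ZMod n × ZMod q := fun p =>
    ((((p.1 : ℤ) - p.2.1 : ℤ) : ZMod n), (((p.1 : ℤ) - r * p.2.2 : ℤ) : ZMod q))
  have hcard : (Finset.univ : Finset (ZMod n × ZMod q)).card < S.card := by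
    simp only [S, Finset.card_univ, Fintype.card_prod, ZMod.card, Finset.card_product,
      Finset.card_range]
    have h1 := Nat.lt_succ_sqrt (n * q)
    have h2 := Nat.lt_succ_sqrt n
    have h3 := Nat.lt_succ_sqrt q
    simp only [Nat.succ_eq_add_one] at h1 h2 h3
    have h4 := Nat.mul_lt_mul'' h1 (Nat.mul_lt_mul'' h2 h3)
    refine lt_of_pow_lt_pow_left₀ 2 (Nat.zero_le _) ?_
    calc (n * q) ^ 2 = n * q * (n * q) := by ring
      _ < _ := h4
      _ = _ := by ring
  obtain ⟨x, hx, y, hy, hne, hxy⟩ := Finset.exists_ne_map_eq_of_card_lt_of_maps_to hcard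
    (f := F) (fun _ _ => by simp)
  have key : ∀ N a b : ℕ, a < N.sqrt + 1 → b < N.sqrt + 1 → ((a : ℤ) - b) ^ 2 ≤ N := by
    intro N a b ha hb
    have h0 : (N.sqrt : ℤ) * N.sqrt ≤ N := by exact_mod_cast Nat.sqrt_le N
    have h1 : |(a : ℤ) - b| ≤ N.sqrt := by rw [abs_le]; constructor <;> omega
    rw [← sq_abs]
    nlinarith [abs_nonneg ((a : ℤ) - b)]
  simp only [S, Finset.mem_product, Finset.mem_range] at hx hy
  simp only [F, Prod.mk.injEq] at hxy
  obtain ⟨e1, e2⟩ := hxy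
  rw [ZMod.intCast_eq_intCast_iff_dvd_sub] at e1 e2
  refine ⟨(y.1 : ℤ) - x.1, (y.2.1 : ℤ) - x.2.1, (y.2.2 : ℤ) - x.2.2, ?_, ?_, ?_, ?_, ?_, ?_⟩
  · rintro ⟨a, b, c⟩
    apply hne
    ext <;> omega
  · exact_mod_cast key (n * q) _ _ hy.1 hx.1
  · exact key _ _ _ hy.2.1 hx.2.1
  · exact key _ _ _ hy.2.2 hx.2.2
  · convert e1 using 1; ring
  · convert e2 using 1; ring

lemma aux_three (n : ℕ) (hn : n % 4 = 2) : ∃ a b c : ℚ, (n : ℚ) = a ^ 2 + b ^ 2 + c ^ 2 := by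
  by_cases hsq : ∃ s : ℤ, s ^ 2 = n
  · obtain ⟨s, hs⟩ := hsq
    exact ⟨s, 0, 0, by rw [← Int.cast_natCast, ← hs]; push_cast; ring⟩
  obtain ⟨q, b, hp, hq4, hb, hnq, hr⟩ := aux_prime n hn
  haveI : Fact q.Prime := ⟨hp⟩
  obtain ⟨α, β, hαβ⟩ := Nat.Prime.sq_add_sq (p := q) (by omega)
  obtain ⟨r', hr'⟩ := hr
  obtain ⟨r, rfl⟩ := ZMod.intCast_surjective r'
  have hr2 : (q : ℤ) ∣ r * r - n := by
    rw [← ZMod.intCast_eq_intCast_iff_dvd_sub]; push_cast; push_cast at hr'; exact hr'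
  obtain ⟨z, s, t, hne, hz, hs, ht, d1, d2⟩ := aux_pigeon n q (by omega) hp.pos r
  have hb' : (q : ℤ) + 1 = b * n := by exact_mod_cast hb
  have hn0 : (0 : ℤ) < n := by exact_mod_cast (by omega : 0 < n)
  have hq0 : (0 : ℤ) < q := by exact_mod_cast hp.pos
  have dn : (n : ℤ) ∣ n * t ^ 2 - z ^ 2 - q * s ^ 2 := by
    have : (n * t ^ 2 - z ^ 2 - q * s ^ 2 : ℤ) = n * (t ^ 2 - b * s ^ 2) - (z - s) * (z + s) := by
      linear_combination (-s ^ 2) * hb'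
    rw [this]
    exact dvd_sub (dvd_mul_right _ _) (Dvd.dvd.mul_right d1 _)
  have dq : (q : ℤ) ∣ n * t ^ 2 - z ^ 2 - q * s ^ 2 := by
    have : (n * t ^ 2 - z ^ 2 - q * s ^ 2 : ℤ) =
      -((r * r - n) * t ^ 2) - (z - r * t) * (z + r * t) - q * s ^ 2 := by ring
    rw [this]
    exact dvd_sub (dvd_sub ((Dvd.dvd.mul_right hr2 _).neg_right) (Dvd.dvd.mul_right d2 _))
      (dvd_mul_right _ _)
  have hcop : IsCoprime (n : ℤ) q := ⟨b, -1, by linear_combination -hb'⟩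
  obtain ⟨m, hm⟩ := hcop.mul_dvd dn dq
  have hs' : s ^ 2 < n := lt_of_le_of_ne hs (fun h => hsq ⟨s, h⟩)
  have ht' : t ^ 2 < q := by
    refine lt_of_le_of_ne ht (fun h => ?_)
    have := (Nat.prime_iff_prime_int.mp hp).irreducible.not_isSquare
    exact this ⟨t, by rw [← h]; ring⟩
  have hnq0 : (0 : ℤ) < n * q := by positivity
  have m1 : m < 1 := by
    by_contra h
    push Not at h
    nlinarith [sq_nonneg z, sq_nonneg s, mul_pos hn0 (sub_pos.mpr ht'), mul_nonneg hq0.le (sq_nonneg s)]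
  have m2 : -2 < m := by
    by_contra h
    push Not at h
    nlinarith [mul_pos hq0 (sub_pos.mpr hs'), mul_nonneg hn0.le (sq_nonneg t)]
  have main : ∃ T X Y : ℤ, T ≠ 0 ∧ (n : ℤ) * T ^ 2 = X ^ 2 + q * Y ^ 2 := by
    obtain rfl | rfl : m = 0 ∨ m = -1 := by omega
    · refine ⟨t, z, s, ?_, by linarith⟩
      rintro rfl
      have h1 : z ^ 2 = 0 := by nlinarith [sq_nonneg z, mul_nonneg hq0.le (sq_nonneg s)]
      have h2 : (q : ℤ) * s ^ 2 = 0 := by nlinarith [sq_nonneg z, mul_nonneg hq0.le (sq_nonneg s)]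
      have h3 : s ^ 2 = 0 := by
        rcases mul_eq_zero.mp h2 with h | h
        · omega
        · exact h
      exact hne ⟨pow_eq_zero_iff (two_ne_zero) |>.mp h1, pow_eq_zero_iff (two_ne_zero) |>.mp h3, rfl⟩
    · refine ⟨t ^ 2 + q, z * t - q * s, z + s * t, by positivity, ?_⟩
      linear_combination (t ^ 2 + q) * hm
  obtain ⟨T, X, Y, hT, h⟩ := main
  have hT' : (T : ℚ) ≠ 0 := by exact_mod_cast hT
  have h' : (n : ℚ) * T ^ 2 = X ^ 2 + (α ^ 2 + β ^ 2) * Y ^ 2 := by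
    rw [← hαβ] at h
    exact_mod_cast h
  refine ⟨X / T, α * Y / T, β * Y / T, ?_⟩
  field_simp
  linear_combination h'

lemma aux_N (N : ℕ) : 0 < N → ∃ a b c : ℚ, (N : ℚ) = a ^ 2 + b ^ 2 + c ^ 2 ∨
    2 * (N : ℚ) = a ^ 2 + b ^ 2 + c ^ 2 := by
  induction N using Nat.strong_induction_on with
  | _ N ih =>
    intro hN
    by_cases h4 : N % 4 = 0
    · obtain ⟨a, b, c, h⟩ := ih (N / 4) (by omega) (by omega)
      have e : (N : ℚ) = 4 * ((N / 4 : ℕ) : ℚ) := by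
        exact_mod_cast (by omega : N = 4 * (N / 4))
      refine ⟨2 * a, 2 * b, 2 * c, ?_⟩
      rw [e]
      rcases h with h | h
      · left; linear_combination 4 * h
      · right; linear_combination 4 * h
    by_cases h2 : N % 4 = 2
    · obtain ⟨a, b, c, h⟩ := aux_three N h2
      exact ⟨a, b, c, Or.inl h⟩
    · obtain ⟨a, b, c, h⟩ := aux_three (2 * N) (by omega)
      exact ⟨a, b, c, Or.inr (by exact_mod_cast h)⟩

lemma aux_pos (u : ℚ) (hu : 0 < u) : ∃ a b c : ℚ,
    (1 - u * (a ^ 2 + b ^ 2 + c ^ 2)) * (1 - 2 * u * (a ^ 2 + b ^ 2 + c ^ 2)) = 0 := by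
  have hnum : 0 < u.num := Rat.num_pos.mpr hu
  obtain ⟨A, hA⟩ := Int.eq_ofNat_of_zero_le hnum.le
  have hA0 : 0 < A := by omega
  have hA1 : (A : ℚ) ≠ 0 := by positivity
  have hD : (u.den : ℚ) ≠ 0 := by exact_mod_cast u.den_nz
  have hu' : u = A / u.den := by
    conv_lhs => rw [← Rat.num_div_den u, hA]
    simp
  obtain ⟨a, b, c, h⟩ := aux_N (A * u.den) (Nat.mul_pos hA0 u.den_pos)
  generalize u.den = D at *
  subst hu'
  push_cast at h
  rcases h with h | h
  · refine ⟨a / A, b / A, c / A, ?_⟩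
    rw [mul_eq_zero]; left
    field_simp
    linear_combination h
  · refine ⟨a / (2 * A), b / (2 * A), c / (2 * A), ?_⟩
    rw [mul_eq_zero]; right
    field_simp
    linear_combination h


theorem boolean_elim_AE3_over_Q (d e f : ℕ) (hd : 0 < d) (he : 0 < e) (hf : 0 < f)
    (t : Fin d → Fin e → ℚ) (u : Fin d → Fin f → ℚ) :
    (∀ i : Fin d, (∃ j : Fin e, t i j = 0) ∨ (∃ k : Fin f, u i k > 0)) ↔
    (∀ v : ℚ, ∃ w₁ w₂ w₃ : ℚ,
      (1 - w₁ * ∏ i : Fin d, (v - (((i : ℕ) + 1 : ℕ) : ℚ))) *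
        (∑ i : Fin d,
          (∏ h ∈ Finset.univ.erase i, (v - (((h : ℕ) + 1 : ℕ) : ℚ))) *
            (∏ j : Fin e, t i j) *
            (∏ k : Fin f,
              (1 - u i k * (w₁ ^ 2 + w₂ ^ 2 + w₃ ^ 2)) *
                (1 - 2 * u i k * (w₁ ^ 2 + w₂ ^ 2 + w₃ ^ 2)))) = 0) := by
  have hsum : ∀ (i₀ : Fin d) (g : Fin d → ℚ),
      (∑ i : Fin d, (∏ h ∈ Finset.univ.erase i,
        ((((i₀ : ℕ) + 1 : ℕ) : ℚ) - (((h : ℕ) + 1 : ℕ) : ℚ))) * g i) =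
      (∏ h ∈ Finset.univ.erase i₀,
        ((((i₀ : ℕ) + 1 : ℕ) : ℚ) - (((h : ℕ) + 1 : ℕ) : ℚ))) * g i₀ := by
    intro i₀ g
    apply Finset.sum_eq_single i₀
    · intro i _ hi
      rw [Finset.prod_eq_zero (i := i₀), zero_mul]
      · simp [Ne.symm hi]
      · simp
    · simp
  have hne : ∀ (i₀ : Fin d), (∏ h ∈ Finset.univ.erase i₀,
        ((((i₀ : ℕ) + 1 : ℕ) : ℚ) - (((h : ℕ) + 1 : ℕ) : ℚ))) ≠ 0 := by
    intro i₀
    rw [Finset.prod_ne_zero_iff]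
    intro h hh he
    rw [sub_eq_zero] at he
    have : (i₀ : ℕ) + 1 = (h : ℕ) + 1 := by exact_mod_cast he
    exact (Finset.mem_erase.mp hh).1 (Fin.ext (by omega))
  constructor
  · intro H v
    by_cases hv : ∃ i₀ : Fin d, v = (((i₀ : ℕ) + 1 : ℕ) : ℚ)
    · obtain ⟨i₀, rfl⟩ := hv
      simp only [mul_assoc (Finset.prod _ _)]
      rcases H i₀ with ⟨j, hj⟩ | ⟨k, hk⟩
      · refine ⟨0, 0, 0, ?_⟩
        rw [hsum i₀, Finset.prod_eq_zero (Finset.mem_univ j) hj]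
        simp
      · obtain ⟨a, b, c, h⟩ := aux_pos _ hk
        refine ⟨a, b, c, ?_⟩
        rw [hsum i₀]
        have := Finset.prod_eq_zero (f := fun k => (1 - u i₀ k * (a ^ 2 + b ^ 2 + c ^ 2)) *
          (1 - 2 * u i₀ k * (a ^ 2 + b ^ 2 + c ^ 2))) (Finset.mem_univ k) h
        simp only [this, mul_zero]
    · push Not at hv
      have hP : (∏ i : Fin d, (v - (((i : ℕ) + 1 : ℕ) : ℚ))) ≠ 0 := by
        rw [Finset.prod_ne_zero_iff]
        intro i _
        exact sub_ne_zero.mpr (hv i)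
      refine ⟨(∏ i : Fin d, (v - (((i : ℕ) + 1 : ℕ) : ℚ)))⁻¹, 0, 0, ?_⟩
      rw [inv_mul_cancel₀ hP]
      simp
  · intro H i₀
    obtain ⟨a, b, c, h⟩ := H (((i₀ : ℕ) + 1 : ℕ) : ℚ)
    have hz : (∏ i : Fin d, ((((i₀ : ℕ) + 1 : ℕ) : ℚ) - (((i : ℕ) + 1 : ℕ) : ℚ))) = 0 :=
      Finset.prod_eq_zero (Finset.mem_univ i₀) (sub_self _)
    rw [hz] at h
    simp only [mul_assoc (Finset.prod _ _)] at h
    rw [hsum i₀, mul_zero, sub_zero, one_mul] at h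
    rcases mul_eq_zero.mp ((mul_eq_zero.mp h).resolve_left (hne i₀)) with h | h
    · left
      obtain ⟨j, _, hj⟩ := Finset.prod_eq_zero_iff.mp h
      exact ⟨j, hj⟩
    · right
      obtain ⟨k, _, hk⟩ := Finset.prod_eq_zero_iff.mp h
      refine ⟨k, ?_⟩
      have hW : 0 ≤ a ^ 2 + b ^ 2 + c ^ 2 := by positivity
      by_contra hu
      push Not at hu
      have := mul_nonneg (neg_nonneg.mpr hu) hW
      rcases mul_eq_zero.mp hk with h | h <;> nlinarith
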